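/- Let p ∈ (0,1) and let (G_t)_{t≥1} be the preferential attachment process with edge-steps with parameter p. Let 𝒞(G_t) denote the number of paths of length 2 (cherries) in G_t. Then for every ε with 0 < ε < 1 there exist positive constants C₁, C₂, C₃ and δ, depending only on ε and p, such that for all t ≥ 2: P( C₁ · t^{(2−p)(1−ε)} ≤ 𝒞(G_t) ≤ C₂ · t^{2−p} · (log t)² ) ≥ 1 − C₃ · t^{−δ}. -/

import Mathlib

open MeasureTheory Filter

attribute [local instance] Classical.propDecidable

/-- Degree of vertex `i` at time `t` computed from the endpoint process `ep`:
the edge added at step `s` contributes `1` for each of its endpoints equal to `i`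
(so a loop at `i` contributes `2`). -/
noncomputable def degOf {Ω : Type} (ep : ℕ → Ω → ℕ × ℕ) (t i : ℕ) (ω : Ω) : ℕ :=
  ∑ s ∈ Finset.Icc 1 t,
    ((if (ep s ω).1 = i then 1 else 0) + (if (ep s ω).2 = i then 1 else 0))

/-- The preferential attachment random graph process with edge-steps and parameter `p`.
`G_1` is a single vertex (labeled `1`) with a loop.  At each step `t + 1` (for `t ≥ 1`),
with probability `p` a vertex-step occurs: a new vertex `nv t + 1` is added together with an
edge to an old vertex `u`, chosen with probability `d_t(u) / (2t)`; with probability `1 - p`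
an edge-step occurs: an edge `{u, w}` is added, where `u` and `w` are chosen independently,
each with probability proportional to its degree.  The field `ep t` records the (ordered pair
of) endpoints of the unique edge added at step `t`, `nv t` is the number of vertices of `G_t`,
and `Z t` tells whether step `t` was a vertex-step.  The one-step conditional laws are
prescribed via conditional expectations with respect to a filtration `ℱ` to which the process
is adapted. -/
structure PAProcess (p : ℝ) where
  Ω : Type
  m0 : MeasurableSpace Ω
  μ : Measure Ω
  isProb : IsProbabilityMeasure μ
  ℱ : Filtration ℕ m0
  Z : ℕ → Ω → Bool
  nv : ℕ → Ω → ℕ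
  ep : ℕ → Ω → ℕ × ℕ
  nv_one : ∀ ω, nv 1 ω = 1
  ep_one : ∀ ω, ep 1 ω = (1, 1)
  nv_succ : ∀ t, 1 ≤ t → ∀ ω, nv (t + 1) ω = nv t ω + (if Z (t + 1) ω then 1 else 0)
  ep_vertexStep : ∀ t, 1 ≤ t → ∀ ω, Z (t + 1) ω = true →
    (ep (t + 1) ω).2 = nv t ω + 1 ∧ 1 ≤ (ep (t + 1) ω).1 ∧ (ep (t + 1) ω).1 ≤ nv t ω
  ep_edgeStep : ∀ t, 1 ≤ t → ∀ ω, Z (t + 1) ω = false →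
    1 ≤ (ep (t + 1) ω).1 ∧ (ep (t + 1) ω).1 ≤ nv t ω ∧
    1 ≤ (ep (t + 1) ω).2 ∧ (ep (t + 1) ω).2 ≤ nv t ω
  Z_meas : ∀ t, Measurable[ℱ t] (Z t)
  nv_meas : ∀ t, Measurable[ℱ t] (nv t)
  ep_meas : ∀ t, Measurable[ℱ t] (ep t)
  condLaw_Z : ∀ t, 1 ≤ t →
    μ[Set.indicator {ω | Z (t + 1) ω = true} (fun _ => (1 : ℝ)) | ℱ t] =ᵐ[μ] fun _ => p
  condLaw_vertex : ∀ t, 1 ≤ t → ∀ u,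
    μ[Set.indicator {ω | Z (t + 1) ω = true ∧ ep (t + 1) ω = (u, nv t ω + 1)}
        (fun _ => (1 : ℝ)) | ℱ t]
      =ᵐ[μ] fun ω => p * (degOf ep t u ω : ℝ) / (2 * t)
  condLaw_edge : ∀ t, 1 ≤ t → ∀ u w,
    μ[Set.indicator {ω | Z (t + 1) ω = false ∧ ep (t + 1) ω = (u, w)}
        (fun _ => (1 : ℝ)) | ℱ t]
      =ᵐ[μ] fun ω => (1 - p) * (degOf ep t u ω : ℝ) * (degOf ep t w ω : ℝ) / (2 * t) ^ 2

namespace PAProcess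

variable {p : ℝ} (P : PAProcess p)

/-- degree `d_t(i)` of vertex `i` in `G_t` (`0` if `i` is not yet present). -/
noncomputable def deg (t i : ℕ) (ω : P.Ω) : ℕ := degOf P.ep t i ω

/-- `i` and `j` are joined by at least one edge in `G_t`. -/
def Joined (t i j : ℕ) (ω : P.Ω) : Prop :=
  ∃ s ∈ Finset.Icc 1 t, P.ep s ω = (i, j) ∨ P.ep s ω = (j, i)

/-- number of triangles of `G_t`: sets of three distinct vertices pairwise joined by at
least one edge (counted without edge multiplicities). -/
noncomputable def triangles (t : ℕ) (ω : P.Ω) : ℕ :=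
  ((Finset.Icc 1 t ×ˢ Finset.Icc 1 t ×ˢ Finset.Icc 1 t).filter
    (fun q => q.1 < q.2.1 ∧ q.2.1 < q.2.2 ∧ P.Joined t q.1 q.2.1 ω ∧
      P.Joined t q.1 q.2.2 ω ∧ P.Joined t q.2.1 q.2.2 ω)).card

/-- number of cherries (paths of length 2) of `G_t`: unordered pairs of distinct edges of
`G_t` sharing a common endpoint.  The edges of `G_t` are indexed by their creation times
`1 ≤ s ≤ t`. -/
noncomputable def cherries (t : ℕ) (ω : P.Ω) : ℕ :=
  ((Finset.Icc 1 t ×ˢ Finset.Icc 1 t).filter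
    (fun q => q.1 < q.2 ∧
      ((P.ep q.1 ω).1 = (P.ep q.2 ω).1 ∨ (P.ep q.1 ω).1 = (P.ep q.2 ω).2 ∨
       (P.ep q.1 ω).2 = (P.ep q.2 ω).1 ∨ (P.ep q.1 ω).2 = (P.ep q.2 ω).2))).card

/-- global clustering coefficient of `G_t`. -/
noncomputable def clustering (t : ℕ) (ω : P.Ω) : ℝ :=
  3 * (P.triangles t ω : ℝ) / (P.cherries t ω : ℝ)

/-- clique number of `G_t`: the largest `k` such that `G_t` contains `k` distinct vertices
pairwise joined by at least one edge. -/
noncomputable def cliqueNum (t : ℕ) (ω : P.Ω) : ℕ :=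
  sSup {k | ∃ S : Finset ℕ, S ⊆ Finset.Icc 1 (P.nv t ω) ∧ S.card = k ∧
    ∀ i ∈ S, ∀ j ∈ S, i ≠ j → P.Joined t i j ω}

/-- `Γ_t(j)`: the number of distinct vertices joined to `j` by at least one edge in `G_t`. -/
noncomputable def nbrCount (t j : ℕ) (ω : P.Ω) : ℕ :=
  ((Finset.Icc 1 t).filter (fun i => P.Joined t i j ω)).card

/-- the time at which vertex `j` is added to the graph. -/
noncomputable def addTime (j : ℕ) (ω : P.Ω) : ℕ := sInf {t | P.nv t ω = j}

/-- at step `s` an edge joining `i` and `j` is added by an edge-step. -/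
def EdgeStepEdge (s i j : ℕ) (ω : P.Ω) : Prop :=
  2 ≤ s ∧ P.Z s ω = false ∧ (P.ep s ω = (i, j) ∨ P.ep s ω = (j, i))

/-- at step `s` an edge joining `i` and `j` is added by a vertex-step. -/
def VertexStepEdge (s i j : ℕ) (ω : P.Ω) : Prop :=
  2 ≤ s ∧ P.Z s ω = true ∧ (P.ep s ω = (i, j) ∨ P.ep s ω = (j, i))

/-- at step `s` vertex `j` is added by a vertex-step and its attaching edge connects it
to vertex `i`. -/
def AttachEdge (s i j : ℕ) (ω : P.Ω) : Prop :=
  2 ≤ s ∧ P.Z s ω = true ∧ P.ep s ω = (i, j) ∧ P.nv s ω = j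

/-- `i` and `j` are joined in `G_t` by at least one edge created at an edge-step. -/
def EdgeJoined (t i j : ℕ) (ω : P.Ω) : Prop :=
  ∃ s ∈ Finset.Icc 1 t, P.EdgeStepEdge s i j ω

/-- `i` and `j` are joined in `G_t` by at least one edge created at a vertex-step. -/
def VJoined (t i j : ℕ) (ω : P.Ω) : Prop :=
  ∃ s ∈ Finset.Icc 1 t, P.VertexStepEdge s i j ω

/-- `i` and `j` are joined in `G_t`, and exclusively by edges created at vertex-steps. -/
def OnlyVertexJoined (t i j : ℕ) (ω : P.Ω) : Prop :=
  P.Joined t i j ω ∧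
    ∀ s ∈ Finset.Icc 1 t, (P.ep s ω = (i, j) ∨ P.ep s ω = (j, i)) → P.Z s ω = true

end PAProcess

section Calculus

lemma one_add_mul_le_exp_of_quadratic {r z q : ℝ} (hr0 : 0 ≤ r) (hq0 : 0 ≤ q)
    (hq1 : q ≤ 1) :
    1 + z * ((2 - r) * q) + z ^ 2 * ((1 - r) * q ^ 2) ≤ Real.exp (q * ((2 - r) * z + z ^ 2)) := by
  have h := Real.add_one_le_exp (q * ((2 - r) * z + z ^ 2))
  have h1 : (1 - r) * q ^ 2 ≤ q := by nlinarith
  nlinarith [mul_le_mul_of_nonneg_left h1 (sq_nonneg z)]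

lemma exp_sub_one_le {x : ℝ} (h0 : 0 ≤ x) (h1 : x ≤ 1) : Real.exp x - 1 ≤ x + x ^ 2 := by
  have h := Real.abs_exp_sub_one_sub_id_le (x := x) (by rw [abs_of_nonneg h0]; exact h1)
  have := (abs_le.1 h).2
  linarith

lemma inv_succ_le_log_sub {s : ℝ} (hs : 0 < s) :
    1 / (s + 1) ≤ Real.log (s + 1) - Real.log s := by
  have h := Real.one_sub_inv_le_log_of_pos (x := (s + 1) / s) (by positivity)
  rw [Real.log_div (by positivity) (by positivity)] at h
  refine le_trans (le_of_eq ?_) h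
  field_simp
  ring

lemma log_sub_le_inv {s : ℝ} (hs : 0 < s) : Real.log (s + 1) - Real.log s ≤ 1 / s := by
  have h := Real.log_le_sub_one_of_pos (x := (s + 1) / s) (by positivity)
  rw [Real.log_div (by positivity) (by positivity)] at h
  refine h.trans (le_of_eq ?_)
  field_simp
  ring

/-- The exponential tilting parameter for the degree of vertex `i` at time `s`. -/
noncomputable def tilt (α i s : ℝ) : ℝ :=
  1 / 100 * ((i / s) ^ α * Real.exp ((i / s) ^ α + 1 / s))

lemma tilt_nonneg (α : ℝ) {i s : ℝ} (hi : 0 ≤ i) (hs : 0 ≤ s) : 0 ≤ tilt α i s := by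
  unfold tilt; positivity

lemma exp_two_le_eight : Real.exp 2 ≤ 8 := by
  have h : Real.exp 2 = Real.exp 1 ^ 2 := by rw [← Real.exp_nat_mul]; norm_num
  rw [h]
  nlinarith [Real.exp_one_lt_d9, Real.exp_pos 1]

lemma tilt_le {α i s : ℝ} (hα : 0 ≤ α) (hi : 0 ≤ i) (his : i ≤ s) (hs : 1 ≤ s) :
    tilt α i s ≤ 8 / 100 * (i / s) ^ α := by
  have h1 : (i / s) ^ α ≤ 1 :=
    Real.rpow_le_one (by positivity) ((div_le_one (by positivity)).2 his) hα
  have h2 : 1 / s ≤ 1 := (div_le_one (by positivity)).2 hs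
  have h3 : Real.exp ((i / s) ^ α + 1 / s) ≤ 8 :=
    (Real.exp_le_exp.2 (by linarith)).trans exp_two_le_eight
  have h4 : 0 ≤ (i / s) ^ α := by positivity
  unfold tilt
  nlinarith

lemma le_tilt {α i s : ℝ} (hi : 0 ≤ i) (hs : 0 ≤ s) : 1 / 100 * (i / s) ^ α ≤ tilt α i s := by
  have h4 : 0 ≤ (i / s) ^ α := by positivity
  have h3 : 1 ≤ Real.exp ((i / s) ^ α + 1 / s) := Real.one_le_exp (by positivity)
  unfold tilt
  nlinarith

lemma tilt_succ_mul_le {α i s : ℝ} (hα : 1 / 2 ≤ α) (hα1 : α ≤ 1) (hi : 1 ≤ i) (his : i ≤ s) :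
    tilt α i (s + 1) * (1 + α / s + 3 * tilt α i (s + 1) / s) ≤ tilt α i s := by
  have hs : 1 ≤ s := hi.trans his
  have hs0 : 0 < s := by linarith
  have hi0 : 0 < i := by linarith
  set x := (i / (s + 1)) ^ α with hx
  set y := (i / s) ^ α with hy
  have hx0 : 0 < x := by positivity
  have hlog := inv_succ_le_log_sub hs0
  have hyx : y = x * Real.exp (α * (Real.log (s + 1) - Real.log s)) := by
    rw [hx, hy, Real.rpow_def_of_pos (by positivity), Real.rpow_def_of_pos (by positivity),
      ← Real.exp_add, Real.log_div (by positivity) (by positivity),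
      Real.log_div (by positivity) (by positivity)]
    ring_nf
  have hE : Real.exp (α / (s + 1)) ≤ Real.exp (α * (Real.log (s + 1) - Real.log s)) := by
    refine Real.exp_le_exp.2 ?_
    have := mul_le_mul_of_nonneg_left hlog (by linarith : 0 ≤ α)
    rwa [mul_one_div] at this
  have hyx1 : x * Real.exp (α / (s + 1)) ≤ y := by
    rw [hyx]; exact mul_le_mul_of_nonneg_left hE hx0.le
  have hyx2 : x + x * (α / (s + 1)) ≤ y := by
    have := Real.add_one_le_exp (α / (s + 1))
    nlinarith
  set θ := tilt α i (s + 1) with hθ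
  have hθle : θ ≤ 8 / 100 * x := tilt_le (by linarith) hi0.le (by linarith) (by linarith)
  have h3 : 3 * θ / s ≤ x * (α / (s + 1)) := by
    rw [mul_div_assoc', div_le_div_iff₀ hs0 (by linarith)]
    have : x * (1 / 2) * s ≤ x * α * s := by gcongr
    nlinarith [mul_le_mul_of_nonneg_right hθle (by linarith : 0 ≤ s + 1)]
  have hfrac : α / s ≤ α / (s + 1) + (1 / s - 1 / (s + 1)) := by
    have : α / s - α / (s + 1) = α * (1 / s - 1 / (s + 1)) := by ring
    have h : 0 ≤ 1 / s - 1 / (s + 1) := sub_nonneg.2 (by gcongr; linarith)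
    nlinarith
  have h5 : 1 + α / s + 3 * θ / s ≤
      Real.exp (α / (s + 1)) * Real.exp ((y + 1 / s) - (x + 1 / (s + 1))) := by
    rw [← Real.exp_add]
    have := Real.add_one_le_exp (α / (s + 1) + ((y + 1 / s) - (x + 1 / (s + 1))))
    linarith
  have hθ0 : 0 ≤ θ := tilt_nonneg α hi0.le (by linarith)
  calc θ * (1 + α / s + 3 * θ / s)
      ≤ θ * (Real.exp (α / (s + 1)) * Real.exp ((y + 1 / s) - (x + 1 / (s + 1)))) :=
        mul_le_mul_of_nonneg_left h5 hθ0
    _ = 1 / 100 * ((x * Real.exp (α / (s + 1))) * Real.exp (y + 1 / s)) := by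
        rw [hθ, Real.exp_sub]; unfold tilt; rw [← hx]
        field_simp
    _ ≤ 1 / 100 * (y * Real.exp (y + 1 / s)) := by gcongr
    _ = tilt α i s := by unfold tilt; rw [← hy]

end Calculus

lemma integral_add_add_add_add {Ω : Type*} [MeasurableSpace Ω]
    {μ : Measure Ω} {a b c d e : Ω → ℝ} (ha : Integrable a μ) (hb : Integrable b μ)
    (hc : Integrable c μ) (hd : Integrable d μ) (he : Integrable e μ) :
    ∫ ω, (a ω + b ω + c ω + d ω + e ω) ∂μ =
      ∫ ω, a ω ∂μ + ∫ ω, b ω ∂μ + ∫ ω, c ω ∂μ + ∫ ω, d ω ∂μ + ∫ ω, e ω ∂μ := by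
  rw [integral_add (by fun_prop) he, integral_add (by fun_prop) hd, integral_add (by fun_prop) hc,
    integral_add ha hb]

namespace PAProcess

variable {p : ℝ} (P : PAProcess p)

section Pathwise

lemma deg_zero (i : ℕ) (ω : P.Ω) : P.deg 0 i ω = 0 := by simp [deg, degOf]

lemma deg_succ (s i : ℕ) (ω : P.Ω) :
    P.deg (s + 1) i ω = P.deg s i ω +
      ((if (P.ep (s + 1) ω).1 = i then 1 else 0) + (if (P.ep (s + 1) ω).2 = i then 1 else 0)) := by
  simp only [deg, degOf]
  rw [Finset.sum_Icc_succ_top (by omega)]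

lemma deg_succ_le (s i : ℕ) (ω : P.Ω) : P.deg (s + 1) i ω ≤ P.deg s i ω + 2 := by
  rw [P.deg_succ]; split_ifs <;> omega

lemma deg_le (s i : ℕ) (ω : P.Ω) : P.deg s i ω ≤ 2 * s := by
  induction s with
  | zero => simp [P.deg_zero]
  | succ s ih => have := P.deg_succ_le s i ω; omega

lemma nv_bounds (s : ℕ) (hs : 1 ≤ s) (ω : P.Ω) : 1 ≤ P.nv s ω ∧ P.nv s ω ≤ s := by
  induction s, hs using Nat.le_induction with
  | base => simp [P.nv_one]
  | succ s hs ih => rw [P.nv_succ s hs]; split_ifs <;> omega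

lemma ep_fst_bounds (s : ℕ) (hs : 1 ≤ s) (ω : P.Ω) :
    1 ≤ (P.ep (s + 1) ω).1 ∧ (P.ep (s + 1) ω).1 ≤ P.nv s ω := by
  rcases hZ : P.Z (s + 1) ω with _ | _
  · have := P.ep_edgeStep s hs ω hZ; omega
  · have := P.ep_vertexStep s hs ω hZ; omega

lemma ep_snd_bounds (s : ℕ) (hs : 1 ≤ s) (ω : P.Ω) :
    1 ≤ (P.ep (s + 1) ω).2 ∧ (P.ep (s + 1) ω).2 ≤ P.nv (s + 1) ω := by
  rcases hZ : P.Z (s + 1) ω with _ | _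
  · have := P.ep_edgeStep s hs ω hZ
    rw [P.nv_succ s hs, hZ]; simp; omega
  · have := P.ep_vertexStep s hs ω hZ
    rw [P.nv_succ s hs, hZ]; simp; omega

lemma nv_le_succ (s : ℕ) (hs : 1 ≤ s) (ω : P.Ω) : P.nv s ω ≤ P.nv (s + 1) ω := by
  rw [P.nv_succ s hs]; omega

lemma ep_mem_Icc (s t : ℕ) (hs : 1 ≤ s) (hst : s ≤ t) (ω : P.Ω) :
    (P.ep s ω).1 ∈ Finset.Icc 1 t ∧ (P.ep s ω).2 ∈ Finset.Icc 1 t := by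
  obtain rfl | ⟨s, rfl, hs'⟩ : s = 1 ∨ ∃ r, s = r + 1 ∧ 1 ≤ r := by
    rcases s with _ | _ | s
    · omega
    · simp
    · right; exact ⟨s + 1, rfl, by omega⟩
  · simp [P.ep_one]; omega
  · have h1 := P.ep_fst_bounds s hs' ω
    have h2 := P.ep_snd_bounds s hs' ω
    have h3 := P.nv_bounds (s + 1) hs ω
    have h4 := P.nv_le_succ s hs' ω
    simp only [Finset.mem_Icc]; omega

/-- A vertex has positive degree exactly when it is present. -/
lemma deg_pos_iff (s : ℕ) (hs : 1 ≤ s) (i : ℕ) (ω : P.Ω) :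
    0 < P.deg s i ω ↔ 1 ≤ i ∧ i ≤ P.nv s ω := by
  induction s, hs using Nat.le_induction with
  | base =>
    rw [P.deg_succ 0, P.deg_zero, P.ep_one, P.nv_one]
    by_cases h : 1 = i
    · simp [h]; omega
    · simp [h]; omega
  | succ s hs ih =>
    have h1 := P.ep_fst_bounds s hs ω
    have h2 := P.ep_snd_bounds s hs ω
    have h3 := P.nv_succ s hs ω
    rw [P.deg_succ]
    rcases hZ : P.Z (s + 1) ω with _ | _
    · simp only [hZ] at h3
      constructor
      · intro h
        by_contra hc
        have : ¬ (0 < P.deg s i ω) := by rw [ih]; simp at h3; omega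
        rw [if_neg (by rintro rfl; simp at h3; omega), if_neg (by rintro rfl; simp at h3; omega)] at h
        omega
      · intro h
        have : 0 < P.deg s i ω := by rw [ih]; simp at h3; omega
        omega
    · have h4 := P.ep_vertexStep s hs ω hZ
      simp only [hZ, if_true] at h3
      constructor
      · intro h
        by_contra hc
        have : ¬ (0 < P.deg s i ω) := by rw [ih]; omega
        rw [if_neg (by rintro rfl; omega), if_neg (by rintro rfl; omega)] at h
        omega
      · intro h
        by_cases hi : i ≤ P.nv s ω
        · have : 0 < P.deg s i ω := by rw [ih]; omega
          omega
        · rw [if_pos (show (P.ep (s + 1) ω).2 = i by omega)]; omega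

lemma deg_self_le_two (i : ℕ) (hi : 1 ≤ i) (ω : P.Ω) : P.deg i i ω ≤ 2 := by
  obtain ⟨s, rfl⟩ : ∃ s, i = s + 1 := ⟨i - 1, by omega⟩
  have h0 : P.deg s (s + 1) ω = 0 := by
    rcases Nat.eq_zero_or_pos s with rfl | hs
    · exact P.deg_zero _ _
    · by_contra h
      have h1 := (P.deg_pos_iff s hs (s + 1) ω).1 (by omega)
      have h2 := P.nv_bounds s hs ω
      omega
  have := P.deg_succ_le s (s + 1) ω
  omega

lemma two_le_deg_one (s : ℕ) (hs : 1 ≤ s) (ω : P.Ω) : 2 ≤ P.deg s 1 ω := by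
  induction s, hs using Nat.le_induction with
  | base => simp [P.deg_succ 0, P.deg_zero, P.ep_one]
  | succ s hs ih => rw [P.deg_succ]; omega

lemma sum_deg (s : ℕ) (ω : P.Ω) : ∑ w ∈ Finset.Icc 1 s, P.deg s w ω = 2 * s := by
  simp only [deg, degOf]
  rw [Finset.sum_comm]
  have : ∀ r ∈ Finset.Icc 1 s, ∑ w ∈ Finset.Icc 1 s,
      ((if (P.ep r ω).1 = w then 1 else 0) + (if (P.ep r ω).2 = w then 1 else 0)) = 2 := by
    intro r hr
    rw [Finset.mem_Icc] at hr
    obtain ⟨h1, h2⟩ := P.ep_mem_Icc r s hr.1 hr.2 ω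
    rw [Finset.sum_add_distrib, Finset.sum_ite_eq, Finset.sum_ite_eq, if_pos h1, if_pos h2]
  rw [Finset.sum_congr rfl this]
  simp; ring

/-- The edges of `G_t` incident to `i`, indexed by their creation times. -/
noncomputable def incident (t i : ℕ) (ω : P.Ω) : Finset ℕ :=
  (Finset.Icc 1 t).filter (fun s => (P.ep s ω).1 = i ∨ (P.ep s ω).2 = i)

lemma card_incident_le (t i : ℕ) (ω : P.Ω) : (P.incident t i ω).card ≤ P.deg t i ω := by
  simp only [incident, deg, degOf, Finset.card_filter]
  gcongr with s hs
  split_ifs <;> omega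

lemma deg_le_card_incident (t i : ℕ) (ω : P.Ω) :
    P.deg t i ω ≤ 2 * (P.incident t i ω).card := by
  simp only [incident, deg, degOf, Finset.card_filter, Finset.mul_sum]
  gcongr with s hs
  split_ifs <;> omega

lemma cherries_le (t : ℕ) (ω : P.Ω) :
    P.cherries t ω ≤ ∑ i ∈ Finset.Icc 1 t, P.deg t i ω ^ 2 := by
  calc P.cherries t ω
      ≤ ((Finset.Icc 1 t).biUnion
          (fun i => P.incident t i ω ×ˢ P.incident t i ω)).card := by
        refine Finset.card_le_card ?_
        rintro ⟨a, b⟩ h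
        simp only [Finset.mem_filter, Finset.mem_product] at h
        obtain ⟨⟨ha, hb⟩, -, h⟩ := h
        have ha' := Finset.mem_Icc.1 ha
        obtain ⟨h1, h2⟩ := P.ep_mem_Icc a t ha'.1 ha'.2 ω
        simp only [Finset.mem_biUnion, Finset.mem_product, incident, Finset.mem_filter]
        rcases h with h | h | h | h
        · exact ⟨_, h1, ⟨ha, .inl rfl⟩, hb, .inl h.symm⟩
        · exact ⟨_, h1, ⟨ha, .inl rfl⟩, hb, .inr h.symm⟩
        · exact ⟨_, h2, ⟨ha, .inr rfl⟩, hb, .inl h.symm⟩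
        · exact ⟨_, h2, ⟨ha, .inr rfl⟩, hb, .inr h.symm⟩
    _ ≤ ∑ i ∈ Finset.Icc 1 t, (P.incident t i ω ×ˢ P.incident t i ω).card :=
        Finset.card_biUnion_le
    _ ≤ _ := by
        gcongr with i hi
        rw [Finset.card_product, sq]
        exact Nat.mul_le_mul (P.card_incident_le t i ω) (P.card_incident_le t i ω)

lemma card_incident_sq_le (t i : ℕ) (ω : P.Ω) :
    (P.incident t i ω).card ^ 2 ≤ 2 * P.cherries t ω + (P.incident t i ω).card := by
  set S := P.incident t i ω with hS
  set A := (S ×ˢ S).filter (fun q => q.1 < q.2) with hA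
  have hAc : A.card ≤ P.cherries t ω := by
    refine Finset.card_le_card ?_
    rintro ⟨a, b⟩ h
    simp only [hA, hS, incident, Finset.mem_filter, Finset.mem_product] at h
    obtain ⟨⟨⟨ha, ha'⟩, hb, hb'⟩, hab⟩ := h
    simp only [Finset.mem_filter, Finset.mem_product]
    refine ⟨⟨ha, hb⟩, hab, ?_⟩
    rcases ha' with h1 | h1 <;> rcases hb' with h2 | h2 <;> simp [h1, h2]
  have hsub : S ×ˢ S ⊆ A ∪ A.image Prod.swap ∪ S.diag := by
    rintro ⟨a, b⟩ h
    simp only [Finset.mem_product] at h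
    simp only [hA, Finset.mem_union, Finset.mem_filter, Finset.mem_product, Finset.mem_image,
      Finset.mem_diag, Prod.exists, Prod.swap_prod_mk, Prod.mk.injEq]
    rcases lt_trichotomy a b with hab | hab | hab
    · exact .inl (.inl ⟨h, hab⟩)
    · exact .inr ⟨h.1, hab⟩
    · exact .inl (.inr ⟨b, a, ⟨⟨h.2, h.1⟩, hab⟩, rfl, rfl⟩)
  have h1 := Finset.card_le_card hsub
  have h2 := Finset.card_union_le (A ∪ A.image Prod.swap) S.diag
  have h3 := Finset.card_union_le A (A.image Prod.swap)
  have h4 : (A.image Prod.swap).card ≤ A.card := Finset.card_image_le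
  rw [Finset.card_product] at h1
  rw [Finset.diag_card] at h2
  rw [sq]
  omega

end Pathwise

attribute [local instance] PAProcess.m0 PAProcess.isProb

section OneStep

lemma measurable_deg (s i : ℕ) : Measurable[P.ℱ s] (P.deg s i) := by
  have : P.deg s i = fun ω => ∑ r ∈ Finset.Icc 1 s,
      ((if (P.ep r ω).1 = i then 1 else 0) + (if (P.ep r ω).2 = i then 1 else 0)) := rfl
  rw [this]
  refine Finset.measurable_fun_sum _ fun r hr => ?_
  have hep : Measurable[P.ℱ s] (P.ep r) :=
    (P.ep_meas r).mono (P.ℱ.mono (Finset.mem_Icc.1 hr).2) le_rfl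
  exact (Measurable.of_discrete (f := fun q : ℕ × ℕ =>
    (if q.1 = i then 1 else 0) + (if q.2 = i then 1 else 0))).comp hep

lemma measurable_comp_deg (s i : ℕ) (G : ℕ → ℝ) :
    Measurable[P.ℱ s] (fun ω => G (P.deg s i ω)) :=
  (Measurable.of_discrete (f := G)).comp (P.measurable_deg s i)

lemma abs_comp_deg_le (s i : ℕ) (G : ℕ → ℝ) (ω : P.Ω) :
    |G (P.deg s i ω)| ≤ ∑ k ∈ Finset.range (2 * s + 1), |G k| :=
  Finset.single_le_sum (f := fun k => |G k|) (fun _ _ => abs_nonneg _)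
    (Finset.mem_range.2 (by have := P.deg_le s i ω; omega))

lemma integrable_comp_deg (s i : ℕ) (G : ℕ → ℝ) :
    Integrable (fun ω => G (P.deg s i ω)) P.μ :=
  Integrable.of_bound
    ((P.measurable_comp_deg s i G).mono (P.ℱ.le s) le_rfl).aestronglyMeasurable _
    (ae_of_all _ fun ω => P.abs_comp_deg_le s i G ω)

/-- Integrating a function of the degree at time `s` against the indicator of an event amounts
to integrating it against the conditional probability of that event. -/
lemma integral_comp_deg_mul_indicator (s i : ℕ) (G : ℕ → ℝ) {A : Set P.Ω} {c : P.Ω → ℝ}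
    (hA : MeasurableSet A)
    (hc : P.μ[A.indicator (fun _ => (1 : ℝ)) | P.ℱ s] =ᵐ[P.μ] c) :
    Integrable (fun ω => G (P.deg s i ω) * A.indicator (fun _ => (1 : ℝ)) ω) P.μ ∧
    Integrable (fun ω => G (P.deg s i ω) * c ω) P.μ ∧
    ∫ ω, G (P.deg s i ω) * A.indicator (fun _ => (1 : ℝ)) ω ∂P.μ =
      ∫ ω, G (P.deg s i ω) * c ω ∂P.μ := by
  have hg := P.measurable_comp_deg s i G
  have hbd : ∀ᵐ ω ∂P.μ, ‖G (P.deg s i ω)‖ ≤ ∑ k ∈ Finset.range (2 * s + 1), |G k| :=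
    ae_of_all _ fun ω => P.abs_comp_deg_le s i G ω
  have hgm := (hg.mono (P.ℱ.le s) le_rfl).aestronglyMeasurable (μ := P.μ)
  have hI : Integrable (A.indicator (fun _ => (1 : ℝ))) P.μ :=
    (integrable_const 1).indicator hA
  have hcI : Integrable c P.μ := integrable_condExp.congr hc
  have h1 : Integrable (fun ω => G (P.deg s i ω) * A.indicator (fun _ => (1 : ℝ)) ω) P.μ :=
    hI.bdd_mul hgm hbd
  refine ⟨h1, hcI.bdd_mul hgm hbd, ?_⟩
  have h2 := condExp_mul_of_stronglyMeasurable_left (μ := P.μ) (m := P.ℱ s)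
    hg.stronglyMeasurable h1 hI
  rw [← integral_condExp (P.ℱ.le s)]
  refine integral_congr_ae (h2.trans ?_)
  filter_upwards [hc] with ω hω
  simp [hω]

lemma measurableSet_vertex (s u : ℕ) :
    MeasurableSet {ω | P.Z (s + 1) ω = true ∧ P.ep (s + 1) ω = (u, P.nv s ω + 1)} := by
  have hZ : Measurable (P.Z (s + 1)) := (P.Z_meas _).mono (P.ℱ.le _) le_rfl
  have hep : Measurable (P.ep (s + 1)) := (P.ep_meas _).mono (P.ℱ.le _) le_rfl
  have hnv : Measurable (P.nv s) := (P.nv_meas _).mono (P.ℱ.le _) le_rfl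
  refine (measurableSet_eq_fun hZ measurable_const).inter (measurableSet_eq_fun hep ?_)
  exact measurable_const.prodMk (hnv.add_const 1)

lemma measurableSet_edge (s u w : ℕ) :
    MeasurableSet {ω | P.Z (s + 1) ω = false ∧ P.ep (s + 1) ω = (u, w)} := by
  have hZ : Measurable (P.Z (s + 1)) := (P.Z_meas _).mono (P.ℱ.le _) le_rfl
  have hep : Measurable (P.ep (s + 1)) := (P.ep_meas _).mono (P.ℱ.le _) le_rfl
  exact (measurableSet_eq_fun hZ measurable_const).inter (measurableSet_eq_fun hep measurable_const)

/-- The indicator that step `s + 1` is a vertex-step attaching the new vertex to `u`. -/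
noncomputable def vertexInd (s u : ℕ) : P.Ω → ℝ :=
  Set.indicator {ω | P.Z (s + 1) ω = true ∧ P.ep (s + 1) ω = (u, P.nv s ω + 1)} (fun _ => (1 : ℝ))

/-- The indicator that step `s + 1` is an edge-step adding the edge `(u, w)`. -/
noncomputable def edgeInd (s u w : ℕ) : P.Ω → ℝ :=
  Set.indicator {ω | P.Z (s + 1) ω = false ∧ P.ep (s + 1) ω = (u, w)} (fun _ => (1 : ℝ))

lemma sum_edgeInd_fst (s i : ℕ) (hs : 1 ≤ s) (ω : P.Ω) :
    ∑ w ∈ Finset.Icc 1 s, P.edgeInd s i w ω =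
      if P.Z (s + 1) ω = false ∧ (P.ep (s + 1) ω).1 = i then 1 else 0 := by
  by_cases h : P.Z (s + 1) ω = false ∧ (P.ep (s + 1) ω).1 = i
  · have hw := P.ep_edgeStep s hs ω h.1
    have hn := P.nv_bounds s hs ω
    rw [if_pos h, Finset.sum_eq_single (P.ep (s + 1) ω).2]
    · simp [edgeInd, h.1, ← h.2]
    · intro w _ hw
      simp [edgeInd, Prod.ext_iff, hw.symm]
    · intro hc; exact absurd (Finset.mem_Icc.2 (by omega)) hc
  · rw [if_neg h]
    refine Finset.sum_eq_zero fun w _ => ?_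
    simp only [edgeInd, Set.indicator_apply, Set.mem_ofPred_eq]
    rw [if_neg]
    rintro ⟨h1, h2⟩
    exact h ⟨h1, by rw [h2]⟩

lemma sum_edgeInd_snd (s i : ℕ) (hs : 1 ≤ s) (ω : P.Ω) :
    ∑ w ∈ Finset.Icc 1 s, P.edgeInd s w i ω =
      if P.Z (s + 1) ω = false ∧ (P.ep (s + 1) ω).2 = i then 1 else 0 := by
  by_cases h : P.Z (s + 1) ω = false ∧ (P.ep (s + 1) ω).2 = i
  · have hw := P.ep_edgeStep s hs ω h.1
    have hn := P.nv_bounds s hs ω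
    rw [if_pos h, Finset.sum_eq_single (P.ep (s + 1) ω).1]
    · simp [edgeInd, h.1, ← h.2]
    · intro w _ hw
      simp [edgeInd, Prod.ext_iff, hw.symm]
    · intro hc; exact absurd (Finset.mem_Icc.2 (by omega)) hc
  · rw [if_neg h]
    refine Finset.sum_eq_zero fun w _ => ?_
    simp only [edgeInd, Set.indicator_apply, Set.mem_ofPred_eq]
    rw [if_neg]
    rintro ⟨h1, h2⟩
    exact h ⟨h1, by rw [h2]⟩

/-- Expansion of a function of the degree (truncated below at `1`) after one step. -/
lemma comp_deg_succ_eq (s i : ℕ) (hs : 1 ≤ s) (φ : ℕ → ℝ) (ω : P.Ω) :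
    φ (max (P.deg (s + 1) i ω) 1) =
      φ (max (P.deg s i ω) 1) +
      (φ (max (P.deg s i ω) 1 + 1) - φ (max (P.deg s i ω) 1)) * P.vertexInd s i ω +
      (φ (max (P.deg s i ω) 1 + 1) - φ (max (P.deg s i ω) 1)) *
        ∑ w ∈ Finset.Icc 1 s, P.edgeInd s i w ω +
      (φ (max (P.deg s i ω) 1 + 1) - φ (max (P.deg s i ω) 1)) *
        ∑ w ∈ Finset.Icc 1 s, P.edgeInd s w i ω +
      (φ (max (P.deg s i ω) 1 + 2) - 2 * φ (max (P.deg s i ω) 1 + 1)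
        + φ (max (P.deg s i ω) 1)) * P.edgeInd s i i ω := by
  rw [P.sum_edgeInd_fst s i hs, P.sum_edgeInd_snd s i hs]
  have hpos := P.deg_pos_iff s hs i ω
  have hsucc := P.deg_succ s i ω
  simp only [vertexInd, edgeInd, Set.indicator_apply, Set.mem_ofPred_eq]
  set d := P.deg s i ω
  obtain ⟨a, b, hab⟩ : ∃ a b, P.ep (s + 1) ω = (a, b) := ⟨_, _, rfl⟩
  rcases Bool.eq_false_or_eq_true (P.Z (s + 1) ω) with hZ | hZ
  · have he := P.ep_vertexStep s hs ω hZ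
    simp only [hab] at he hsucc
    by_cases h1 : a = i
    · have hd : max d 1 = d := max_eq_left (hpos.2 (by omega))
      have : max (P.deg (s + 1) i ω) 1 = d + 1 := by
        rw [hsucc, if_pos h1, if_neg (by omega)]; omega
      rw [this, hd]; simp [hZ, hab, h1, he.1]
    · have : max (P.deg (s + 1) i ω) 1 = max d 1 := by
        rw [hsucc, if_neg h1]
        by_cases h2 : b = i
        · have : ¬ 0 < d := by rw [hpos]; omega
          rw [if_pos h2]; omega
        · simp [h2]
      rw [this]; simp [hZ, hab, h1]
  · have he := P.ep_edgeStep s hs ω hZ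
    simp only [hab] at he hsucc
    by_cases h1 : a = i
    · have hd : max d 1 = d := max_eq_left (hpos.2 (by omega))
      by_cases h2 : b = i
      · have : max (P.deg (s + 1) i ω) 1 = d + 2 := by
          rw [hsucc, if_pos h1, if_pos h2]; omega
        rw [this, hd]; simp [hZ, hab, h1, h2]; ring
      · have : max (P.deg (s + 1) i ω) 1 = d + 1 := by
          rw [hsucc, if_pos h1, if_neg h2]; omega
        rw [this, hd]; simp [hZ, hab, h1, h2]
    · by_cases h2 : b = i
      · have hd : max d 1 = d := max_eq_left (hpos.2 (by omega))
        have : max (P.deg (s + 1) i ω) 1 = d + 1 := by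
          rw [hsucc, if_neg h1, if_pos h2]; omega
        rw [this, hd]; simp [hZ, hab, h1, h2]
      · have : max (P.deg (s + 1) i ω) 1 = max d 1 := by
          simp [hsucc, h1, h2]
        rw [this]; simp [hZ, hab, h1, h2]

/-- One-step evolution of the mean of a function of the degree truncated below at `1`. -/
lemma integral_comp_deg_succ (s i : ℕ) (hs : 1 ≤ s) (φ : ℕ → ℝ) :
    ∫ ω, φ (max (P.deg (s + 1) i ω) 1) ∂P.μ =
      ∫ ω, (φ (max (P.deg s i ω) 1) +
        (φ (max (P.deg s i ω) 1 + 1) - φ (max (P.deg s i ω) 1)) *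
          ((2 - p) * ((P.deg s i ω : ℝ) / (2 * s))) +
        (φ (max (P.deg s i ω) 1 + 2) - 2 * φ (max (P.deg s i ω) 1 + 1)
          + φ (max (P.deg s i ω) 1)) * ((1 - p) * ((P.deg s i ω : ℝ) / (2 * s)) ^ 2)) ∂P.μ := by
  have hs0 : (s : ℝ) ≠ 0 := by positivity
  set G0 : ℕ → ℝ := fun d => φ (max d 1) with hG0
  set G1 : ℕ → ℝ := fun d => φ (max d 1 + 1) - φ (max d 1) with hG1
  set G2 : ℕ → ℝ := fun d => φ (max d 1 + 2) - 2 * φ (max d 1 + 1) + φ (max d 1) with hG2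
  obtain ⟨v1, v2, v3⟩ := P.integral_comp_deg_mul_indicator s i G1 (P.measurableSet_vertex s i)
    (P.condLaw_vertex s hs i)
  have e1 := fun w => P.integral_comp_deg_mul_indicator s i G1 (P.measurableSet_edge s i w)
    (P.condLaw_edge s hs i w)
  have e2 := fun w => P.integral_comp_deg_mul_indicator s i G1 (P.measurableSet_edge s w i)
    (P.condLaw_edge s hs w i)
  obtain ⟨l1, l2, l3⟩ := P.integral_comp_deg_mul_indicator s i G2 (P.measurableSet_edge s i i)
    (P.condLaw_edge s hs i i)
  have i0 := P.integrable_comp_deg s i G0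
  have hL : ∀ ω, φ (max (P.deg (s + 1) i ω) 1) = G0 (P.deg s i ω) +
      G1 (P.deg s i ω) * P.vertexInd s i ω +
      ∑ w ∈ Finset.Icc 1 s, G1 (P.deg s i ω) * P.edgeInd s i w ω +
      ∑ w ∈ Finset.Icc 1 s, G1 (P.deg s i ω) * P.edgeInd s w i ω +
      G2 (P.deg s i ω) * P.edgeInd s i i ω := by
    intro ω
    rw [P.comp_deg_succ_eq s i hs φ ω, Finset.mul_sum, Finset.mul_sum]
  have hsum : ∀ ω, ∑ w ∈ Finset.Icc 1 s, (degOf P.ep s w ω : ℝ) = 2 * s := by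
    intro ω
    exact_mod_cast P.sum_deg s ω
  have hR : ∀ ω, (G0 (P.deg s i ω) + G1 (P.deg s i ω) *
        ((2 - p) * ((P.deg s i ω : ℝ) / (2 * s))) +
        G2 (P.deg s i ω) * ((1 - p) * ((P.deg s i ω : ℝ) / (2 * s)) ^ 2)) = G0 (P.deg s i ω) +
      G1 (P.deg s i ω) * (p * (degOf P.ep s i ω : ℝ) / (2 * s)) +
      ∑ w ∈ Finset.Icc 1 s, G1 (P.deg s i ω) *
        ((1 - p) * (degOf P.ep s i ω : ℝ) * (degOf P.ep s w ω : ℝ) / (2 * s) ^ 2) +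
      ∑ w ∈ Finset.Icc 1 s, G1 (P.deg s i ω) *
        ((1 - p) * (degOf P.ep s w ω : ℝ) * (degOf P.ep s i ω : ℝ) / (2 * s) ^ 2) +
      G2 (P.deg s i ω) *
        ((1 - p) * (degOf P.ep s i ω : ℝ) * (degOf P.ep s i ω : ℝ) / (2 * s) ^ 2) := by
    intro ω
    have h1 : ∑ w ∈ Finset.Icc 1 s, G1 (P.deg s i ω) *
        ((1 - p) * (degOf P.ep s i ω : ℝ) * (degOf P.ep s w ω : ℝ) / (2 * s) ^ 2) =
        G1 (P.deg s i ω) * ((1 - p) * ((P.deg s i ω : ℝ) / (2 * s))) := by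
      rw [← Finset.mul_sum, ← Finset.sum_div, ← Finset.mul_sum, hsum]
      simp only [deg]
      field_simp
    have h2 : ∑ w ∈ Finset.Icc 1 s, G1 (P.deg s i ω) *
        ((1 - p) * (degOf P.ep s w ω : ℝ) * (degOf P.ep s i ω : ℝ) / (2 * s) ^ 2) =
        G1 (P.deg s i ω) * ((1 - p) * ((P.deg s i ω : ℝ) / (2 * s))) := by
      rw [← h1]
      exact Finset.sum_congr rfl fun w _ => by ring
    rw [h1, h2]
    simp only [deg]
    ring
  have hR' := integral_congr_ae (μ := P.μ) (ae_of_all _ hR)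
  have hL' := integral_congr_ae (μ := P.μ) (ae_of_all _ hL)
  refine hL'.trans (Eq.trans ?_ hR'.symm)
  have f1 := integrable_finsetSum (Finset.Icc 1 s) fun w _ => (e1 w).1
  have f2 := integrable_finsetSum (Finset.Icc 1 s) fun w _ => (e2 w).1
  have f1' := integrable_finsetSum (Finset.Icc 1 s) fun w _ => (e1 w).2.1
  have f2' := integrable_finsetSum (Finset.Icc 1 s) fun w _ => (e2 w).2.1
  simp only [vertexInd, edgeInd]
  rw [integral_add_add_add_add i0 v1 f1 f2 l1, integral_add_add_add_add i0 v2 f1' f2' l2, v3, l3,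
    integral_finsetSum _ fun w _ => (e1 w).1, integral_finsetSum _ fun w _ => (e2 w).1,
    integral_finsetSum _ fun w _ => (e1 w).2.1, integral_finsetSum _ fun w _ => (e2 w).2.1]
  congr 2
  · congr 1
    exact Finset.sum_congr rfl fun w _ => (e1 w).2.2
  · exact Finset.sum_congr rfl fun w _ => (e2 w).2.2

end OneStep

section Moments

lemma integral_exp_tilt_succ_le (hp0 : 0 ≤ p) (hp1 : p ≤ 1) (i s : ℕ) (hi : 1 ≤ i) (his : i ≤ s) :
    ∫ ω, Real.exp (tilt (1 - p / 2) i (s + 1 : ℕ) * (max (P.deg (s + 1) i ω) 1 : ℕ)) ∂P.μ ≤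
      ∫ ω, Real.exp (tilt (1 - p / 2) i s * (max (P.deg s i ω) 1 : ℕ)) ∂P.μ := by
  have hs : 1 ≤ s := hi.trans his
  have hiR : (1 : ℝ) ≤ i := by exact_mod_cast hi
  have hisR : (i : ℝ) ≤ s := by exact_mod_cast his
  have hs0 : (0 : ℝ) < s := by linarith
  set θ := tilt (1 - p / 2) i (s + 1 : ℕ) with hθ
  have hθs : θ * (1 + (1 - p / 2) / s + 3 * θ / s) ≤ tilt (1 - p / 2) i s := by
    have := tilt_succ_mul_le (α := 1 - p / 2) (i := i) (s := s) (by linarith) (by linarith) hiR hisR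
    rw [hθ]; push_cast; exact this
  have hθ0 : 0 ≤ θ := tilt_nonneg _ (by positivity) (by positivity)
  have hθ1 : θ ≤ 1 := by
    have h := tilt_le (α := 1 - p / 2) (i := i) (s := (s + 1 : ℕ)) (by linarith) (by positivity)
      (by push_cast; linarith) (by push_cast; linarith)
    have h1 : ((i : ℝ) / (s + 1 : ℕ)) ^ (1 - p / 2) ≤ 1 :=
      Real.rpow_le_one (by positivity)
        ((div_le_one (by positivity)).2 (by push_cast; linarith)) (by linarith)
    rw [← hθ] at h
    linarith
  rw [P.integral_comp_deg_succ s i hs (fun k => Real.exp (θ * k))]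
  refine integral_mono ?_ (P.integrable_comp_deg s i
    (fun d => Real.exp (tilt (1 - p / 2) i s * (max d 1 : ℕ)))) fun ω => ?_
  · exact P.integrable_comp_deg s i (fun d => Real.exp (θ * (max d 1 : ℕ)) +
        (Real.exp (θ * (max d 1 + 1 : ℕ)) - Real.exp (θ * (max d 1 : ℕ))) *
          ((2 - p) * ((d : ℝ) / (2 * s))) +
        (Real.exp (θ * (max d 1 + 2 : ℕ)) - 2 * Real.exp (θ * (max d 1 + 1 : ℕ))
          + Real.exp (θ * (max d 1 : ℕ))) * ((1 - p) * ((d : ℝ) / (2 * s)) ^ 2))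
  · simp only
    have hd := P.deg_le s i ω
    set d := P.deg s i ω
    set X := max d 1
    set q : ℝ := (d : ℝ) / (2 * s) with hq
    set z := Real.exp θ - 1 with hz
    have hq0 : 0 ≤ q := by positivity
    have hq1 : q ≤ 1 := by
      rw [hq, div_le_one (by positivity)]; exact_mod_cast hd
    have hqX : q ≤ X / (2 * s) := by
      rw [hq]; gcongr; exact le_max_left _ _
    have hz0 : 0 ≤ z := by rw [hz]; linarith [Real.one_le_exp hθ0]
    have hz1 : z ≤ θ + θ ^ 2 := exp_sub_one_le hθ0 hθ1
    have e1 : Real.exp (θ * (X + 1 : ℕ)) = Real.exp (θ * X) * (1 + z) := by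
      rw [hz, add_sub_cancel, ← Real.exp_add]; push_cast; ring_nf
    have e2 : Real.exp (θ * (X + 2 : ℕ)) = Real.exp (θ * X) * (1 + z) ^ 2 := by
      rw [hz, add_sub_cancel, ← Real.exp_nat_mul, ← Real.exp_add]; push_cast; ring_nf
    rw [e1, e2]
    have hbase := one_add_mul_le_exp_of_quadratic (z := z) hp0 hq0 hq1
    have hexp : q * ((2 - p) * z + z ^ 2) ≤
        X / (2 * s) * ((2 - p) * θ + 6 * θ ^ 2) := by
      have hz2 : z ^ 2 ≤ 4 * θ ^ 2 := by
        have : z ≤ 2 * θ := by nlinarith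
        nlinarith
      have h1 : (2 - p) * z ≤ (2 - p) * (θ + θ ^ 2) :=
        mul_le_mul_of_nonneg_left hz1 (by linarith)
      have h2 : (2 - p) * z + z ^ 2 ≤ (2 - p) * θ + 6 * θ ^ 2 := by
        nlinarith [sq_nonneg θ]
      have h3 : 0 ≤ (2 - p) * z + z ^ 2 := by
        have : 0 ≤ (2 - p) * z := mul_nonneg (by linarith) hz0
        positivity
      exact mul_le_mul hqX h2 h3 (by positivity)
    calc _ = Real.exp (θ * X) * (1 + z * ((2 - p) * q) + z ^ 2 * ((1 - p) * q ^ 2)) := by ring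
      _ ≤ Real.exp (θ * X) * Real.exp (X / (2 * s) * ((2 - p) * θ + 6 * θ ^ 2)) := by
          gcongr
          exact hbase.trans (Real.exp_le_exp.2 hexp)
      _ = Real.exp (θ * (1 + (1 - p / 2) / s + 3 * θ / s) * X) := by
          rw [← Real.exp_add]; congr 1; field_simp; ring
      _ ≤ Real.exp (tilt (1 - p / 2) i s * X) := by gcongr

lemma integral_exp_tilt_le (hp0 : 0 ≤ p) (hp1 : p ≤ 1) (i t : ℕ) (hi : 1 ≤ i) (hit : i ≤ t) :
    ∫ ω, Real.exp (tilt (1 - p / 2) i t * (max (P.deg t i ω) 1 : ℕ)) ∂P.μ ≤ Real.exp 1 := by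
  induction t, hit using Nat.le_induction with
  | base =>
    have hiR : (1 : ℝ) ≤ i := by exact_mod_cast hi
    have h := tilt_le (α := 1 - p / 2) (i := i) (s := i) (by linarith) (by positivity) le_rfl hiR
    rw [div_self (by positivity), Real.one_rpow] at h
    have h0 := tilt_nonneg (1 - p / 2) (i := i) (s := i) (by positivity) (by positivity)
    calc _ ≤ ∫ _, Real.exp 1 ∂P.μ := by
          refine integral_mono (P.integrable_comp_deg i i
            (fun d => Real.exp (tilt (1 - p / 2) i i * (max d 1 : ℕ)))) (integrable_const _)
            fun ω => ?_
          refine Real.exp_le_exp.2 ?_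
          have hd : max (P.deg i i ω) 1 ≤ 2 := max_le (P.deg_self_le_two i hi ω) (by norm_num)
          have hd' : ((max (P.deg i i ω) 1 : ℕ) : ℝ) ≤ 2 := by exact_mod_cast hd
          nlinarith
      _ = Real.exp 1 := by simp
  | succ t hit ih => exact (P.integral_exp_tilt_succ_le hp0 hp1 i t hi hit).trans ih

/-- Exponential upper tail of the degree of vertex `i` on the scale `(t / i) ^ (1 - p / 2)`. -/
lemma measureReal_deg_ge_le (hp0 : 0 ≤ p) (hp1 : p ≤ 1) (i t : ℕ) (hi : 1 ≤ i) (hit : i ≤ t)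
    {x : ℝ} (hx : 0 ≤ x) :
    P.μ.real {ω | 100 * x * ((t : ℝ) / i) ^ (1 - p / 2) ≤ P.deg t i ω} ≤
      Real.exp 1 * Real.exp (-x) := by
  have ht : (0 : ℝ) < t := by exact_mod_cast (by omega : 0 < t)
  have hi0 : (0 : ℝ) < i := by exact_mod_cast (by omega : 0 < i)
  have hmk := mul_meas_ge_le_integral_of_nonneg (μ := P.μ)
    (f := fun ω => Real.exp (tilt (1 - p / 2) i t * (max (P.deg t i ω) 1 : ℕ)))
    (ae_of_all _ fun _ => (Real.exp_pos _).le)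
    (P.integrable_comp_deg t i (fun d => Real.exp (tilt (1 - p / 2) i t * (max d 1 : ℕ))))
    (Real.exp x)
  have hsub : P.μ.real {ω | 100 * x * ((t : ℝ) / i) ^ (1 - p / 2) ≤ P.deg t i ω} ≤
      P.μ.real {ω | Real.exp x ≤
        Real.exp (tilt (1 - p / 2) i t * (max (P.deg t i ω) 1 : ℕ))} := by
    refine measureReal_mono fun ω hω => ?_
    simp only [Set.mem_ofPred_eq] at hω ⊢
    refine Real.exp_le_exp.2 ?_
    have h1 := le_tilt (α := 1 - p / 2) hi0.le ht.le
    have h2 : (P.deg t i ω : ℝ) ≤ (max (P.deg t i ω) 1 : ℕ) := by exact_mod_cast le_max_left _ _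
    have h3 : ((i : ℝ) / t) ^ (1 - p / 2) * ((t : ℝ) / i) ^ (1 - p / 2) = 1 := by
      rw [← Real.mul_rpow (by positivity) (by positivity)]
      field_simp
      simp
    calc x = 1 / 100 * ((i : ℝ) / t) ^ (1 - p / 2) *
          (100 * x * ((t : ℝ) / i) ^ (1 - p / 2)) := by linear_combination -x * h3
      _ ≤ _ := mul_le_mul h1 (hω.trans h2) (by positivity) (tilt_nonneg _ hi0.le ht.le)
  have hI := P.integral_exp_tilt_le hp0 hp1 i t hi hit
  rw [Real.exp_neg, ← div_eq_mul_inv, le_div_iff₀ (Real.exp_pos x), mul_comm]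
  exact (mul_le_mul_of_nonneg_left hsub (Real.exp_pos x).le).trans (hmk.trans hI)

lemma integral_inv_deg_one_succ_le (hp0 : 0 ≤ p) (s : ℕ) (hs : 1 ≤ s) :
    ∫ ω, ((P.deg (s + 1) 1 ω : ℝ) - 1)⁻¹ ∂P.μ ≤
      Real.exp (-(1 - p / 2) / s + (1 / s - 1 / (s + 1))) *
        ∫ ω, ((P.deg s 1 ω : ℝ) - 1)⁻¹ ∂P.μ := by
  have hs0 : (1 : ℝ) ≤ s := by exact_mod_cast hs
  have hmax : ∀ s, 1 ≤ s → ∀ ω, max (P.deg s 1 ω) 1 = P.deg s 1 ω := fun s hs ω =>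
    max_eq_left (by have := P.two_le_deg_one s hs ω; omega)
  have hstep := P.integral_comp_deg_succ s 1 hs (fun k => ((k : ℝ) - 1)⁻¹)
  simp only [hmax s hs, hmax (s + 1) (by omega)] at hstep
  rw [hstep, ← integral_const_mul]
  refine integral_mono ?_ ((P.integrable_comp_deg s 1 (fun d => ((d : ℝ) - 1)⁻¹)).const_mul _)
    fun ω => ?_
  · exact P.integrable_comp_deg s 1 (fun d => ((d : ℝ) - 1)⁻¹ +
        (((d + 1 : ℕ) - 1 : ℝ)⁻¹ - ((d : ℝ) - 1)⁻¹) * ((2 - p) * ((d : ℝ) / (2 * s))) +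
        (((d + 2 : ℕ) - 1 : ℝ)⁻¹ - 2 * ((d + 1 : ℕ) - 1 : ℝ)⁻¹ + ((d : ℝ) - 1)⁻¹) *
          ((1 - p) * ((d : ℝ) / (2 * s)) ^ 2))
  · simp only
    have hd : (2 : ℝ) ≤ P.deg s 1 ω := by exact_mod_cast P.two_le_deg_one s hs ω
    push_cast
    set d : ℝ := (P.deg s 1 ω : ℝ)
    have h1 : d - 1 ≠ 0 := by linarith
    have h2 : d + 1 ≠ 0 := by linarith
    have h3 : d ≠ 0 := by linarith
    have h4 : (s : ℝ) ≠ 0 := by linarith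
    have e3 : d + 2 - 1 = d + 1 := by ring
    have e4 : d + 1 - 1 = d := by ring
    have hbound : (1 - p) * d / (2 * s ^ 2 * (d + 1)) ≤ (1 : ℝ) / s - 1 / (s + 1) := by
      have : (1 : ℝ) / s - 1 / (s + 1) = 1 / (s * (s + 1)) := by field_simp; ring
      rw [this, div_le_div_iff₀ (by positivity) (by positivity)]
      have h5 : (1 - p) * d ≤ d + 1 := by nlinarith
      have h6 : (s : ℝ) * (s + 1) ≤ 2 * s ^ 2 := by nlinarith
      have h7 := mul_le_mul h5 h6 (by positivity) (by linarith)
      linarith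
    have hE := Real.add_one_le_exp (-(1 - p / 2) / (s : ℝ) + (1 / (s : ℝ) - 1 / (s + 1)))
    calc _ = (-(1 - p / 2) / (s : ℝ) + (1 - p) * d / (2 * s ^ 2 * (d + 1)) + 1) * (d - 1)⁻¹ := by
          rw [e3, e4]; field_simp; ring
      _ ≤ _ := by
          refine mul_le_mul_of_nonneg_right ?_ (inv_nonneg.2 (by linarith))
          linarith

lemma integral_inv_deg_one_le (hp0 : 0 ≤ p) (hp1 : p ≤ 1) (t : ℕ) (ht : 1 ≤ t) :
    ∫ ω, ((P.deg t 1 ω : ℝ) - 1)⁻¹ ∂P.μ ≤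
      Real.exp (1 - 1 / t) * (t : ℝ) ^ (-(1 - p / 2)) := by
  induction t, ht using Nat.le_induction with
  | base =>
    have : ∀ ω, P.deg 1 1 ω = 2 := fun ω => by
      have := P.two_le_deg_one 1 le_rfl ω
      have := P.deg_self_le_two 1 le_rfl ω
      omega
    simp only [this]
    norm_num
  | succ t ht ih =>
    have ht0 : (0 : ℝ) < t := by exact_mod_cast (by omega : 0 < t)
    refine (P.integral_inv_deg_one_succ_le hp0 t ht).trans
      ((mul_le_mul_of_nonneg_left ih (Real.exp_pos _).le).trans ?_)
    rw [Real.rpow_def_of_pos ht0, Real.rpow_def_of_pos (by positivity), ← Real.exp_add,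
      ← Real.exp_add, ← Real.exp_add]
    refine Real.exp_le_exp.2 ?_
    have := mul_le_mul_of_nonneg_left (log_sub_le_inv ht0) (by linarith : 0 ≤ 1 - p / 2)
    have e : -(1 - p / 2) / (t : ℝ) = -((1 - p / 2) * (1 / t)) := by ring
    push_cast
    rw [e]
    linarith

/-- Lower tail of the degree of the first vertex on the scale `t ^ (1 - p / 2)`. -/
lemma measureReal_deg_one_le (hp0 : 0 ≤ p) (hp1 : p ≤ 1) (t : ℕ) (ht : 1 ≤ t) {x : ℝ}
    (hx : 0 < x) :
    P.μ.real {ω | (P.deg t 1 ω : ℝ) - 1 ≤ x} ≤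
      Real.exp 1 * x * (t : ℝ) ^ (-(1 - p / 2)) := by
  have ht0 : (0 : ℝ) < t := by exact_mod_cast (by omega : 0 < t)
  have hd : ∀ ω, (1 : ℝ) ≤ (P.deg t 1 ω : ℝ) - 1 := fun ω => by
    have : (2 : ℝ) ≤ P.deg t 1 ω := by exact_mod_cast P.two_le_deg_one t ht ω
    linarith
  have hmk := mul_meas_ge_le_integral_of_nonneg (μ := P.μ)
    (f := fun ω => ((P.deg t 1 ω : ℝ) - 1)⁻¹)
    (ae_of_all _ fun ω => inv_nonneg.2 (by linarith [hd ω]))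
    (P.integrable_comp_deg t 1 (fun d => ((d : ℝ) - 1)⁻¹)) x⁻¹
  have hsub : P.μ.real {ω | (P.deg t 1 ω : ℝ) - 1 ≤ x} ≤
      P.μ.real {ω | x⁻¹ ≤ ((P.deg t 1 ω : ℝ) - 1)⁻¹} := by
    refine measureReal_mono fun ω hω => ?_
    have hpos : 0 < (P.deg t 1 ω : ℝ) - 1 := by linarith [hd ω]
    exact inv_anti₀ hpos hω
  have hI := P.integral_inv_deg_one_le hp0 hp1 t ht
  have hI' : Real.exp (1 - 1 / t) * (t : ℝ) ^ (-(1 - p / 2)) ≤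
      Real.exp 1 * (t : ℝ) ^ (-(1 - p / 2)) := by
    gcongr
    have : 0 ≤ 1 / (t : ℝ) := by positivity
    linarith
  have h := (mul_le_mul_of_nonneg_left hsub (inv_nonneg.2 hx.le)).trans (hmk.trans (hI.trans hI'))
  rw [inv_mul_le_iff₀ hx] at h
  linarith

end Moments

section CherryBounds

lemma cherries_le_of_deg_le (hp1 : p < 1) (t : ℕ) {x : ℝ} {ω : P.Ω}
    (h : ∀ i ∈ Finset.Icc 1 t, (P.deg t i ω : ℝ) ≤ x * ((t : ℝ) / i) ^ (1 - p / 2)) :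
    (P.cherries t ω : ℝ) ≤ x ^ 2 * (t : ℝ) ^ (2 - p) * ∑' n : ℕ, 1 / (n : ℝ) ^ (2 - p) := by
  have hsum : Summable fun n : ℕ => 1 / (n : ℝ) ^ (2 - p) :=
    Real.summable_one_div_nat_rpow.2 (by linarith)
  calc (P.cherries t ω : ℝ) ≤ ∑ i ∈ Finset.Icc 1 t, (P.deg t i ω : ℝ) ^ 2 := by
        exact_mod_cast P.cherries_le t ω
    _ ≤ ∑ i ∈ Finset.Icc 1 t, x ^ 2 * (t : ℝ) ^ (2 - p) * (1 / (i : ℝ) ^ (2 - p)) := by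
        refine Finset.sum_le_sum fun i hi => ?_
        calc (P.deg t i ω : ℝ) ^ 2 ≤ (x * ((t : ℝ) / i) ^ (1 - p / 2)) ^ 2 :=
              pow_le_pow_left₀ (by positivity) (h i hi) 2
          _ = _ := by
              rw [mul_pow, ← Real.rpow_mul_natCast (by positivity),
                show (1 - p / 2) * (2 : ℕ) = 2 - p by push_cast; ring,
                Real.div_rpow (by positivity) (by positivity)]
              ring
    _ ≤ _ := by
        rw [← Finset.mul_sum]
        gcongr
        exact hsum.sum_le_tsum _ fun n _ => by positivity

lemma le_cherries_of_le_deg (t i : ℕ) {x : ℝ} (hx : 1 ≤ x) {ω : P.Ω}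
    (h : 2 * x ≤ (P.deg t i ω : ℝ) - 1) : 3 / 8 * x ^ 2 ≤ P.cherries t ω := by
  have h1 : (P.deg t i ω : ℝ) ≤ 2 * (P.incident t i ω).card := by
    exact_mod_cast P.deg_le_card_incident t i ω
  have h2 : ((P.incident t i ω).card : ℝ) ^ 2 ≤
      2 * P.cherries t ω + (P.incident t i ω).card := by
    exact_mod_cast P.card_incident_sq_le t i ω
  nlinarith

end CherryBounds

end PAProcess

/-- **Theorem (Concentration for cherries).**
For `p ∈ (0,1)` and every `0 < ε < 1` there are positive constants `C₁, C₂, C₃, δ`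
(depending only on `ε` and `p`) such that for all `t ≥ 2`,
`P(C₁ t^{(2-p)(1-ε)} ≤ 𝒞(G_t) ≤ C₂ t^{2-p} (log t)²) ≥ 1 - C₃ t^{-δ}`. -/
theorem cherries_concentration (p : ℝ) (hp0 : 0 < p) (hp1 : p < 1)
    (P : PAProcess p) (ε : ℝ) (hε0 : 0 < ε) (hε1 : ε < 1) :
    ∃ C₁ C₂ C₃ δ : ℝ, 0 < C₁ ∧ 0 < C₂ ∧ 0 < C₃ ∧ 0 < δ ∧
      ∀ t : ℕ, 2 ≤ t →
        1 - C₃ * (t : ℝ) ^ (-δ) ≤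
          (P.μ {ω |
            C₁ * (t : ℝ) ^ ((2 - p) * (1 - ε)) ≤ (P.cherries t ω : ℝ) ∧
            (P.cherries t ω : ℝ) ≤ C₂ * (t : ℝ) ^ (2 - p) * Real.log t ^ 2}).toReal := by
  let _ := P.m0
  have _ := P.isProb
  set S : ℝ := ∑' n : ℕ, 1 / (n : ℝ) ^ (2 - p) with hS
  have hS0 : 0 ≤ S := tsum_nonneg fun n => by positivity
  refine ⟨3 / 8, 200 ^ 2 * (S + 1), 2 * Real.exp 1 + Real.exp 1, (1 - p / 2) * ε, by norm_num,
    by positivity, by positivity, mul_pos (by linarith) hε0, fun t ht => ?_⟩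
  have ht1 : (1 : ℝ) ≤ t := by exact_mod_cast (by omega : 1 ≤ t)
  have ht0 : (0 : ℝ) < t := by linarith
  have hlog : 0 ≤ Real.log t := Real.log_nonneg ht1
  set G := {ω | 3 / 8 * (t : ℝ) ^ ((2 - p) * (1 - ε)) ≤ (P.cherries t ω : ℝ) ∧
    (P.cherries t ω : ℝ) ≤ 200 ^ 2 * (S + 1) * (t : ℝ) ^ (2 - p) * Real.log t ^ 2} with hG
  set L := {ω | (P.deg t 1 ω : ℝ) - 1 ≤ 2 * (t : ℝ) ^ ((1 - p / 2) * (1 - ε))} with hL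
  set U : ℕ → Set P.Ω := fun i =>
    {ω | 100 * (2 * Real.log t) * ((t : ℝ) / i) ^ (1 - p / 2) ≤ P.deg t i ω} with hU
  have hcover : (Set.univ : Set P.Ω) ⊆ G ∪ (L ∪ ⋃ i ∈ Finset.Icc 1 t, U i) := by
    intro ω _
    by_contra hω
    simp only [Set.mem_union, not_or, Set.mem_iUnion, not_exists] at hω
    obtain ⟨hωG, hωL, hωU⟩ := hω
    refine hωG ⟨?_, ?_⟩
    · have h := P.le_cherries_of_le_deg t 1
        (Real.one_le_rpow ht1 (mul_nonneg (by linarith) (by linarith))) (not_le.1 hωL).le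
      rw [← Real.rpow_mul_natCast ht0.le] at h
      convert h using 3
      push_cast; ring
    · have h := P.cherries_le_of_deg_le hp1 t (x := 100 * (2 * Real.log t)) (ω := ω)
        fun i hi => (not_le.1 (hωU i hi)).le
      refine h.trans ?_
      rw [← hS]
      have : 0 ≤ (t : ℝ) ^ (2 - p) * Real.log t ^ 2 := by positivity
      nlinarith
  have hLp : P.μ.real L ≤ 2 * Real.exp 1 * (t : ℝ) ^ (-((1 - p / 2) * ε)) := by
    refine (P.measureReal_deg_one_le hp0.le hp1.le t (by omega) (by positivity)).trans
      (le_of_eq ?_)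
    rw [show -((1 - p / 2) * ε) = (1 - p / 2) * (1 - ε) + -(1 - p / 2) by ring,
      Real.rpow_add ht0]
    ring
  have hUp : P.μ.real (⋃ i ∈ Finset.Icc 1 t, U i) ≤
      Real.exp 1 * (t : ℝ) ^ (-((1 - p / 2) * ε)) := by
    calc P.μ.real (⋃ i ∈ Finset.Icc 1 t, U i)
        ≤ ∑ i ∈ Finset.Icc 1 t, P.μ.real (U i) := measureReal_biUnion_finset_le _ _
      _ ≤ ∑ _i ∈ Finset.Icc 1 t, Real.exp 1 * Real.exp (-(2 * Real.log t)) := by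
          refine Finset.sum_le_sum fun i hi => ?_
          rw [Finset.mem_Icc] at hi
          exact P.measureReal_deg_ge_le hp0.le hp1.le i t hi.1 hi.2 (by positivity)
      _ = Real.exp 1 * (t : ℝ) ^ (-1 : ℝ) := by
          have : Real.exp (-(2 * Real.log t)) = (t : ℝ) ^ (-1 : ℝ) * (t : ℝ) ^ (-1 : ℝ) := by
            rw [Real.rpow_def_of_pos ht0, ← Real.exp_add]; ring_nf
          rw [Finset.sum_const, Nat.card_Icc, this, Real.rpow_neg_one]
          simp only [Nat.add_sub_cancel, nsmul_eq_mul]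
          field_simp
      _ ≤ _ := by
          gcongr
          nlinarith
  have hone : 1 ≤ P.μ.real G + (P.μ.real L + P.μ.real (⋃ i ∈ Finset.Icc 1 t, U i)) := by
    rw [← probReal_univ (μ := P.μ)]
    exact (measureReal_mono hcover).trans ((measureReal_union_le _ _).trans
      (add_le_add_right (measureReal_union_le _ _) _))
  change _ ≤ P.μ.real G
  linarith
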